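/- For every function f smooth on V_reg and every u ∈ V, the function D_u^k f is smooth on V_reg, and the Dunkl-type operators pairwise commute: for all u, u′ ∈ V one has D_u^k(D_{u′}^k f) = D_{u′}^k(D_u^k f) on V_reg. -/

import Mathlib

open scoped BigOperators
open RealInnerProductSpace

noncomputable section

/-- The coroot `α∨` of a root `α`, under the identification of `V*` with `V`
via the inner product: `ξ(α∨) = 2⟨ξ,α⟩/‖α‖²`. -/
def coroot {V : Type*} [NormedAddCommGroup V] [InnerProductSpace ℝ V] (α : V) : V :=
  (2 / ‖α‖ ^ 2) • α

/-- The orthogonal reflection `s_α` in the hyperplane orthogonal to `α`: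
`s_α(ξ) = ξ − ξ(α∨)·α = ξ − α(ξ)·α∨`. -/
def sRefl {V : Type*} [NormedAddCommGroup V] [InnerProductSpace ℝ V] (α v : V) : V :=
  v - ⟪α, v⟫ • coroot α

/-- A finite, irreducible, reduced, crystallographic root system `Σ₀` in the dual of
the Euclidean space `V` (identified with `V` via the inner product), together with a
fixed base of simple roots, the positive roots, and the highest root. -/
structure RootSystemBase (V : Type*) [NormedAddCommGroup V] [InnerProductSpace ℝ V]
    [FiniteDimensional ℝ V] where
  roots : Finset V
  roots_nonempty : roots.Nonempty
  ne_zero : ∀ α ∈ roots, α ≠ (0 : V)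
  /-- reduced -/
  reduced : ∀ α ∈ roots, ∀ c : ℝ, c • α ∈ roots → c = 1 ∨ c = -1
  /-- crystallographic: `β(α∨) ∈ ℤ` -/
  crystallographic : ∀ α ∈ roots, ∀ β ∈ roots, ∃ m : ℤ, ⟪β, coroot α⟫ = (m : ℝ)
  /-- stable under the reflections `s_α` -/
  refl_mem : ∀ α ∈ roots, ∀ β ∈ roots, sRefl α β ∈ roots
  /-- `Σ₀` spans `V*` -/
  spanning : Submodule.span ℝ (roots : Set V) = ⊤
  /-- irreducible: no nontrivial orthogonal decomposition -/
  irreducible : ∀ s : Finset V, s ⊆ roots →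
    (∀ α ∈ s, ∀ β ∈ roots, β ∉ s → ⟪α, β⟫ = 0) → s = ∅ ∨ s = roots
  /-- the fixed base of simple roots -/
  simples : Finset V
  simples_sub : simples ⊆ roots
  simples_indep : LinearIndependent ℝ (fun β : {x // x ∈ simples} => (β : V))
  /-- the positive roots w.r.t. the base -/
  pos : Finset V
  pos_sub : pos ⊆ roots
  simples_sub_pos : simples ⊆ pos
  pos_or_neg : ∀ α ∈ roots, (α ∈ pos ∧ -α ∉ pos) ∨ (α ∉ pos ∧ -α ∈ pos)
  pos_combo : ∀ α ∈ pos, ∃ c : V → ℝ, (∀ β, 0 ≤ c β) ∧ α = ∑ β ∈ simples, c β • β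
  /-- the highest root `φ` -/
  hroot : V
  hroot_pos : hroot ∈ pos
  hroot_highest : ∀ α ∈ roots, ∃ c : V → ℝ, (∀ β, 0 ≤ c β) ∧
    hroot - α = ∑ β ∈ simples, c β • β

variable {V : Type*} [NormedAddCommGroup V] [InnerProductSpace ℝ V] [FiniteDimensional ℝ V]

/-- The Weyl group `W₀`: the subgroup of linear automorphisms of `V` generated by the
orthogonal reflections in the roots. -/
def weylGroup (R : RootSystemBase V) : Subgroup (V ≃ₗ[ℝ] V) :=
  Subgroup.closure {w : V ≃ₗ[ℝ] V | ∃ α ∈ R.roots, ∀ v, w v = sRefl α v}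

/-- A strictly positive `W₀`-invariant multiplicity function. -/
def IsMultiplicity (R : RootSystemBase V) (k : V → ℝ) : Prop :=
  (∀ α ∈ R.roots, 0 < k α) ∧
  (∀ w : V ≃ₗ[ℝ] V, w ∈ weylGroup R → ∀ α ∈ R.roots, k (w α) = k α)

/-- `σ_η^k = Σ_{α∈Σ₀} arctan(η(α∨)/k_α)·α`. -/
def sigmaFun (R : RootSystemBase V) (k : V → ℝ) (η : V) : V :=
  ∑ α ∈ R.roots, Real.arctan (⟪η, coroot α⟫ / k α) • α

/-- The master function
`S_k(μ,ξ) = ½‖ξ‖² − 2π⟨μ,ξ⟩ + ½ Σ_{α∈Σ₀} ‖α‖² ∫₀^{ξ(α∨)} arctan(t/k_α) dt`. -/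
def masterFun (R : RootSystemBase V) (k : V → ℝ) (μ ξ : V) : ℝ :=
  ‖ξ‖ ^ 2 / 2 - 2 * Real.pi * ⟪μ, ξ⟫ +
    (1 / 2) * ∑ α ∈ R.roots, ‖α‖ ^ 2 * ∫ t in (0:ℝ)..(⟪ξ, coroot α⟫), Real.arctan (t / k α)

/-- Membership in the weight lattice `P = {λ ∈ V* : λ(α∨) ∈ ℤ ∀α ∈ Σ₀}`. -/
def IsWeight (R : RootSystemBase V) (lam : V) : Prop :=
  ∀ α ∈ R.roots, ∃ m : ℤ, ⟪lam, coroot α⟫ = (m : ℝ)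

/-- `η ∈ V*` is a Bethe root: `λ = iη` solves the Bethe ansatz equations
`e^{(wλ)(φ∨)} = ∏_{α∈Σ₀⁺} ((wλ)(α∨) − k_α)/((wλ)(α∨) + k_α))^{α(φ∨)}` for all `w ∈ W₀`,
where `m α = α(φ∨) ∈ ℤ≥0`. -/
def IsBetheRoot (R : RootSystemBase V) (k : V → ℝ) (m : V → ℕ) (η : V) : Prop :=
  ∀ w : V ≃ₗ[ℝ] V, w ∈ weylGroup R →
    Complex.exp (Complex.I * (⟪w η, coroot R.hroot⟫ : ℝ)) =
      ∏ α ∈ R.pos,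
        ((Complex.I * (⟪w η, coroot α⟫ : ℝ) - (k α : ℂ)) /
         (Complex.I * (⟪w η, coroot α⟫ : ℝ) + (k α : ℂ))) ^ (m α)

end

noncomputable section

/-- The set of regular vectors: the complement of the union of all affine root
hyperplanes `{v : α(v) + m = 0}` (`α ∈ Σ₀`, `m ∈ ℤ`). -/
def VregSet {V : Type*} [NormedAddCommGroup V] [InnerProductSpace ℝ V]
    [FiniteDimensional ℝ V] (R : RootSystemBase V) : Set V :=
  {v : V | ∀ α ∈ R.roots, ∀ mm : ℤ, ⟪α, v⟫ + (mm : ℝ) ≠ 0}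

/-- A positive affine root `a = (α,m)`: `α ∈ Σ₀` and either `m > 0`, or `m = 0` and
`α ∈ Σ₀⁺`. -/
def IsPosAffine {V : Type*} [NormedAddCommGroup V] [InnerProductSpace ℝ V]
    [FiniteDimensional ℝ V] (R : RootSystemBase V) (a : V × ℤ) : Prop :=
  a.1 ∈ R.roots ∧ (0 < a.2 ∨ (a.2 = 0 ∧ a.1 ∈ R.pos))

/-- The affine reflection `s_a(v) = v − (α(v)+m)·α∨` associated to `a = (α,m)`. -/
def affRefl {V : Type*} [NormedAddCommGroup V] [InnerProductSpace ℝ V]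
    (a : V × ℤ) (v : V) : V :=
  v - (⟪a.1, v⟫ + (a.2 : ℝ)) • coroot a.1

/-- The Dunkl-type operator:
`(D_u^k f)(v) = (∂_u f)(v) + Σ k_α α(u) f(s_a(v))`, the (finite) sum running over the
positive affine roots `a = (α,m)` with `α(v) + m < 0`. -/
def dunkl {V : Type*} [NormedAddCommGroup V] [InnerProductSpace ℝ V]
    [FiniteDimensional ℝ V] (R : RootSystemBase V) (k : V → ℝ)
    (u : V) (f : V → ℂ) (v : V) : ℂ :=
  fderiv ℝ f v u +
    ∑ᶠ a ∈ {a : V × ℤ | IsPosAffine R a ∧ ⟪a.1, v⟫ + (a.2 : ℝ) < 0},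
      ((k a.1 * ⟪a.1, u⟫ : ℝ) : ℂ) * f (affRefl a v)

end

section DunklCommutation

variable {V : Type*} [NormedAddCommGroup V] [InnerProductSpace ℝ V]

/-! ### Reflections -/

lemma inner_coroot_self {α : V} (hα : α ≠ 0) : ⟪α, coroot α⟫ = 2 := by
  have : ‖α‖ ≠ 0 := norm_ne_zero_iff.mpr hα
  rw [coroot, real_inner_smul_right, real_inner_self_eq_norm_sq]
  field_simp

lemma inner_smul_coroot (α v : V) : ⟪α, v⟫ • coroot α = ⟪v, coroot α⟫ • α := by
  rw [coroot, real_inner_smul_right, smul_smul, real_inner_comm, mul_comm]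

lemma coroot_neg (α : V) : coroot (-α) = -coroot α := by
  simp [coroot]

lemma sRefl_eq_sub (α v : V) : sRefl α v = v - ⟪v, coroot α⟫ • α := by
  rw [sRefl, inner_smul_coroot]

lemma sRefl_add (α v w : V) : sRefl α (v + w) = sRefl α v + sRefl α w := by
  simp only [sRefl, inner_add_right, add_smul]; abel

lemma sRefl_smul (α : V) (c : ℝ) (v : V) : sRefl α (c • v) = c • sRefl α v := by
  simp only [sRefl, real_inner_smul_right, smul_sub, smul_smul]

/-- The reflection `s_α` as a linear map. -/
noncomputable def reflLin (α : V) : V →ₗ[ℝ] V where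
  toFun := sRefl α
  map_add' := sRefl_add α
  map_smul' := sRefl_smul α

lemma sRefl_self {α : V} (hα : α ≠ 0) : sRefl α α = -α := by
  rw [sRefl, inner_smul_coroot, inner_coroot_self hα, two_smul]; abel

lemma inner_sRefl_self {α : V} (hα : α ≠ 0) (v : V) : ⟪α, sRefl α v⟫ = -⟪α, v⟫ := by
  rw [sRefl, inner_sub_right, real_inner_smul_right, inner_coroot_self hα]; ring

lemma sRefl_sRefl {α : V} (hα : α ≠ 0) (v : V) : sRefl α (sRefl α v) = v := by
  rw [sRefl, inner_sRefl_self hα, sRefl, neg_smul]; abel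

lemma inner_sRefl_left (α v w : V) : ⟪sRefl α v, w⟫ = ⟪v, sRefl α w⟫ := by
  simp only [sRefl, coroot, inner_sub_left, inner_sub_right, real_inner_smul_left,
    real_inner_smul_right, real_inner_comm v α]
  ring

lemma norm_sRefl {α : V} (hα : α ≠ 0) (v : V) : ‖sRefl α v‖ = ‖v‖ := by
  rw [norm_eq_sqrt_real_inner, norm_eq_sqrt_real_inner, inner_sRefl_left, sRefl_sRefl hα]

lemma coroot_sRefl {α : V} (hα : α ≠ 0) (β : V) : coroot (sRefl α β) = sRefl α (coroot β) := by
  rw [coroot, coroot, norm_sRefl hα, sRefl_smul]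

lemma affRefl_add (a : V × ℤ) (x y : V) : affRefl a (x + y) = affRefl a x + sRefl a.1 y := by
  simp only [affRefl, sRefl, inner_add_right, add_smul]; abel

lemma inner_affRefl_self {a : V × ℤ} (ha : a.1 ≠ 0) (v : V) :
    ⟪a.1, affRefl a v⟫ + (a.2 : ℝ) = -(⟪a.1, v⟫ + (a.2 : ℝ)) := by
  rw [affRefl, inner_sub_right, real_inner_smul_right, inner_coroot_self ha]; ring

lemma affRefl_affRefl {a : V × ℤ} (ha : a.1 ≠ 0) (v : V) : affRefl a (affRefl a v) = v := by
  rw [affRefl, inner_affRefl_self ha, affRefl, neg_smul]; abel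

lemma contDiff_affRefl (a : V × ℤ) {n : WithTop ℕ∞} : ContDiff ℝ n (affRefl a) := by
  unfold affRefl
  exact contDiff_id.sub (((contDiff_const.inner ℝ contDiff_id).add contDiff_const).smul
    contDiff_const)

variable [FiniteDimensional ℝ V]

lemma hasFDerivAt_affRefl (a : V × ℤ) (v : V) :
    HasFDerivAt (affRefl a) (LinearMap.toContinuousLinearMap (reflLin a.1)) v := by
  have h : affRefl a = fun v => LinearMap.toContinuousLinearMap (reflLin a.1) v + affRefl a 0 := by
    funext v
    have := affRefl_add a 0 v
    rw [zero_add] at this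
    rw [this, add_comm]; rfl
  rw [h]
  exact (ContinuousLinearMap.hasFDerivAt _).add_const _

/-! ### The action of affine reflections on affine roots -/

/-- The image of the affine root `b` under the affine reflection `s_a`. -/
noncomputable def reflAffine (a b : V × ℤ) : V × ℤ :=
  (sRefl a.1 b.1, b.2 - a.2 * round ⟪b.1, coroot a.1⟫)

variable {R : RootSystemBase V}

lemma round_inner_coroot {α β : V} (hα : α ∈ R.roots) (hβ : β ∈ R.roots) :
    (round ⟪β, coroot α⟫ : ℝ) = ⟪β, coroot α⟫ := by
  obtain ⟨m, hm⟩ := R.crystallographic α hα β hβ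
  rw [hm, round_intCast]

lemma eval_reflAffine {a b : V × ℤ} (ha : a.1 ∈ R.roots) (hb : b.1 ∈ R.roots) (v : V) :
    ⟪(reflAffine a b).1, v⟫ + ((reflAffine a b).2 : ℝ) = ⟪b.1, affRefl a v⟫ + (b.2 : ℝ) := by
  simp only [reflAffine, affRefl, inner_sRefl_left]
  push_cast
  rw [round_inner_coroot ha hb, sRefl]
  simp only [inner_sub_right, real_inner_smul_right]
  ring

lemma affRefl_reflAffine {a b : V × ℤ} (ha : a.1 ∈ R.roots) (hb : b.1 ∈ R.roots) (v : V) :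
    affRefl (reflAffine a b) v = affRefl a (affRefl b (affRefl a v)) := by
  have h0 := R.ne_zero _ ha
  rw [affRefl, eval_reflAffine ha hb]
  conv_rhs => rw [affRefl.eq_1 b, sub_eq_add_neg, affRefl_add, affRefl_affRefl h0, ← neg_smul,
    sRefl_smul, ← coroot_sRefl h0, neg_smul, ← sub_eq_add_neg]
  rfl

lemma reflAffine_mem {a b : V × ℤ} (ha : a.1 ∈ R.roots) (hb : b.1 ∈ R.roots) :
    (reflAffine a b).1 ∈ R.roots := R.refl_mem _ ha _ hb

lemma reflAffine_reflAffine {a b : V × ℤ} (ha : a.1 ∈ R.roots) (hb : b.1 ∈ R.roots) :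
    reflAffine a (reflAffine a b) = b := by
  have h1 : (reflAffine a (reflAffine a b)).1 = b.1 := sRefl_sRefl (R.ne_zero _ ha) _
  refine Prod.ext h1 ?_
  have h := eval_reflAffine ha (reflAffine_mem ha hb) 0
  rw [eval_reflAffine ha hb, affRefl_affRefl (R.ne_zero _ ha), h1] at h
  exact_mod_cast add_left_cancel h

lemma reflAffine_self {a : V × ℤ} (ha : a.1 ∈ R.roots) : reflAffine a a = (-a.1, -a.2) := by
  have h0 := R.ne_zero _ ha
  have h2 : round ⟪a.1, coroot a.1⟫ = 2 := by
    rw [inner_coroot_self h0]; exact_mod_cast round_intCast (α := ℝ) 2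
  rw [reflAffine, sRefl_self h0, h2]
  congr 1; ring

lemma neg_mem_roots {α : V} (hα : α ∈ R.roots) : -α ∈ R.roots := by
  rw [← sRefl_self (R.ne_zero _ hα)]; exact R.refl_mem _ hα _ hα

lemma multiplicity_sRefl {k : V → ℝ} (hk : IsMultiplicity R k) {α β : V} (hα : α ∈ R.roots)
    (hβ : β ∈ R.roots) : k (sRefl α β) = k β :=
  hk.2 (LinearEquiv.ofInvolutive (reflLin α) (sRefl_sRefl (R.ne_zero _ hα)))
    (Subgroup.subset_closure ⟨α, hα, fun _ => rfl⟩) β hβ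

lemma IsPosAffine.not_neg {a : V × ℤ} (ha : IsPosAffine R a) : ¬ IsPosAffine R (-a.1, -a.2) := by
  rintro ⟨-, h⟩
  rcases ha with ⟨h1, h2⟩
  have := R.pos_or_neg _ h1
  grind

/-! ### Regular vectors -/

lemma affRefl_mem_VregSet {a : V × ℤ} (ha : a.1 ∈ R.roots) {v : V} (hv : v ∈ VregSet R) :
    affRefl a v ∈ VregSet R := by
  intro β hβ m
  have := eval_reflAffine ha (b := (β, m)) hβ v
  rw [← this]
  exact hv _ (reflAffine_mem ha hβ) _

lemma isOpen_VregSet : IsOpen (VregSet R) := by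
  have : VregSet R = ⋂ α ∈ R.roots, (fun v : V => ⟪α, v⟫) ⁻¹' (Set.range ((↑) : ℤ → ℝ))ᶜ := by
    ext v
    simp only [VregSet, Set.mem_ofPred_eq, Set.mem_iInter, Set.mem_preimage, Set.mem_compl_iff,
      Set.mem_range, not_exists]
    refine forall₂_congr fun α _ => ⟨fun h m hm => h (-m) ?_, fun h m hm => h (-m) ?_⟩
    · push_cast; linarith
    · push_cast; linarith
  rw [this]
  exact isOpen_biInter_finset fun α _ =>
    (Int.isClosedEmbedding_coe_real.isClosed_range.isOpen_compl).preimage (by fun_prop)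

variable (R) in
/-- The positive affine roots that are negative at `v`. -/
def negAt (v : V) : Set (V × ℤ) := {a | IsPosAffine R a ∧ ⟪a.1, v⟫ + (a.2 : ℝ) < 0}

lemma finite_negAt (v : V) : (negAt R v).Finite := by
  refine (R.roots.finite_toSet.biUnion fun α _ =>
    (Set.finite_Icc (0 : ℤ) ⌈-⟪α, v⟫⌉).image (Prod.mk α)).subset ?_
  rintro ⟨α, m⟩ ⟨⟨h1, h2⟩, h3⟩
  simp only at h1 h2 h3
  simp only [Set.mem_iUnion]
  refine ⟨α, h1, m, ⟨by omega, ?_⟩, rfl⟩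
  have : (m : ℝ) ≤ ⌈-⟪α, v⟫⌉ := (by linarith : (m : ℝ) ≤ -⟪α, v⟫).trans (Int.le_ceil _)
  exact_mod_cast this

lemma negAt_eventually_eq {v : V} (hv : v ∈ VregSet R) : ∀ᶠ w in nhds v, negAt R w = negAt R v := by
  have key : ∀ α ∈ R.roots, ∀ᶠ w in nhds v, ⌊⟪α, w⟫⌋ = ⌊⟪α, v⟫⌋ := by
    intro α hα
    have hc : ContinuousAt (fun w : V => ⟪α, w⟫) v := by fun_prop
    have hlt : (⌊⟪α, v⟫⌋ : ℝ) < ⟪α, v⟫ := by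
      refine lt_of_le_of_ne (Int.floor_le _) fun h => hv α hα (-⌊⟪α, v⟫⌋) ?_
      push_cast; linarith
    filter_upwards [hc.eventually (Ioo_mem_nhds hlt (Int.lt_floor_add_one _))] with w hw
    exact Int.floor_eq_iff.mpr ⟨hw.1.le, hw.2⟩
  filter_upwards [(R.roots.eventually_all).mpr key] with w hw
  ext ⟨α, m⟩
  refine and_congr_right fun h => ?_
  have (x : V) : ⟪α, x⟫ + (m : ℝ) < 0 ↔ ⌊⟪α, x⟫⌋ < -m := by
    rw [Int.floor_lt]; push_cast; constructor <;> intro h <;> linarith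
  simp only [this, hw α h.1]

/-! ### Simple affine roots -/

variable (R) in
/-- The cone spanned by the simple roots. -/
def simpleCone : Set V := {x | ∃ c : V → ℝ, (∀ β, 0 ≤ c β) ∧ x = ∑ β ∈ R.simples, c β • β}

lemma simpleCone_add {x y : V} (hx : x ∈ simpleCone R) (hy : y ∈ simpleCone R) :
    x + y ∈ simpleCone R := by
  obtain ⟨c, hc, rfl⟩ := hx
  obtain ⟨d, hd, rfl⟩ := hy
  exact ⟨c + d, fun β => add_nonneg (hc β) (hd β), by simp [add_smul, Finset.sum_add_distrib]⟩

lemma simpleCone_smul {x : V} (hx : x ∈ simpleCone R) {t : ℝ} (ht : 0 ≤ t) :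
    t • x ∈ simpleCone R := by
  obtain ⟨c, hc, rfl⟩ := hx
  exact ⟨t • c, fun β => mul_nonneg ht (hc β), by simp [Finset.smul_sum, smul_smul]⟩

lemma coeff_unique {c d : V → ℝ}
    (h : ∑ β ∈ R.simples, c β • β = ∑ β ∈ R.simples, d β • β) {β : V} (hβ : β ∈ R.simples) :
    c β = d β := by
  have hli := linearIndependent_iff'.mp R.simples_indep Finset.univ (fun β => c β - d β) (by
    rw [Finset.sum_coe_sort R.simples (fun β => (c β - d β) • β)]
    simp only [sub_smul, Finset.sum_sub_distrib, h, sub_self]) ⟨β, hβ⟩ (Finset.mem_univ _)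
  exact sub_eq_zero.mp hli

lemma simpleCone_salient {x : V} (hx : x ∈ simpleCone R) (hx' : -x ∈ simpleCone R) : x = 0 := by
  obtain ⟨c, hc, rfl⟩ := hx
  obtain ⟨d, hd, h⟩ := hx'
  refine Finset.sum_eq_zero fun β hβ => ?_
  have : (-c) β = d β := coeff_unique (by simpa using h) hβ
  have h0 : c β = 0 := le_antisymm (by have := hd β; simp only [Pi.neg_apply] at *; linarith) (hc β)
  rw [h0, zero_smul]

lemma mem_pos_of_mem_simpleCone {α : V} (hα : α ∈ R.roots) (h : α ∈ simpleCone R) : α ∈ R.pos := by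
  rcases R.pos_or_neg α hα with h' | h'
  · exact h'.1
  · exact absurd (simpleCone_salient h (R.pos_combo _ h'.2)) (R.ne_zero _ hα)

lemma sRefl_mem_pos_of_simple {α β : V} (hα : α ∈ R.simples) (hβ : β ∈ R.pos) (hne : β ≠ α) :
    sRefl α β ∈ R.pos := by
  classical
  have hαr := R.simples_sub hα
  have hβr := R.pos_sub hβ
  have hmem := R.refl_mem _ hαr _ hβr
  rcases R.pos_or_neg _ hmem with h' | h'
  · exact h'.1
  obtain ⟨c, hc, hcs⟩ := R.pos_combo _ hβ
  obtain ⟨d, hd, hds⟩ := R.pos_combo _ h'.2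
  exfalso
  have hvan : ∀ γ ∈ R.simples, γ ≠ α → c γ = 0 := by
    intro γ hγ hγα
    have hsum : ∑ δ ∈ R.simples, (c + d) δ • δ =
        ∑ δ ∈ R.simples, (Pi.single α ⟪β, coroot α⟫ : V → ℝ) δ • δ := by
      simp only [Pi.add_apply, add_smul, Finset.sum_add_distrib, ← hcs, ← hds]
      rw [Finset.sum_eq_single_of_mem α hα (fun b _ hb => by simp [hb])]
      rw [sRefl_eq_sub, Pi.single_eq_same]; abel
    have := coeff_unique hsum hγ
    simp only [Pi.add_apply, Pi.single_eq_of_ne hγα] at this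
    linarith [hc γ, hd γ]
  have hβα : β = c α • α := by
    rw [hcs, Finset.sum_eq_single_of_mem α hα (fun b hb hbα => by simp [hvan b hb hbα])]
  rcases R.reduced α hαr (c α) (hβα ▸ hβr) with h | h
  · exact hne (by rw [hβα, h, one_smul])
  · linarith [hc α]

lemma hroot_mem : R.hroot ∈ R.roots := R.pos_sub R.hroot_pos

lemma hroot_inner_nonneg {β : V} (hβ : β ∈ R.pos) : 0 ≤ ⟪β, R.hroot⟫ := by
  classical
  obtain ⟨c, hc, hcs⟩ := R.pos_combo _ hβ
  rw [hcs, sum_inner]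
  refine Finset.sum_nonneg fun α hα => ?_
  rw [real_inner_smul_left]
  refine mul_nonneg (hc α) ?_
  have hαr := R.simples_sub hα
  obtain ⟨d, hd, hds⟩ := R.hroot_highest _ (R.refl_mem _ hαr _ hroot_mem)
  have hsum : ∑ δ ∈ R.simples, (Pi.single α ⟪R.hroot, coroot α⟫ : V → ℝ) δ • δ =
      ∑ δ ∈ R.simples, d δ • δ := by
    rw [← hds, sRefl_eq_sub,
      Finset.sum_eq_single_of_mem α hα (fun b _ hb => by simp [hb]), Pi.single_eq_same]
    abel
  have h := coeff_unique hsum hα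
  rw [Pi.single_eq_same] at h
  have h0 : 0 ≤ ⟪R.hroot, coroot α⟫ := h ▸ hd α
  rw [coroot, real_inner_smul_right] at h0
  rw [real_inner_comm]
  have : 0 < ‖α‖ := norm_pos_iff.mpr (R.ne_zero _ hαr)
  exact nonneg_of_mul_nonneg_right h0 (by positivity)

lemma hroot_coroot_nonneg {β : V} (hβ : β ∈ R.pos) : 0 ≤ ⟪β, coroot R.hroot⟫ := by
  rw [coroot, real_inner_smul_right]
  exact mul_nonneg (by positivity) (hroot_inner_nonneg hβ)

/-- A root pairing with `φ∨` to at least `2` is the highest root `φ`. -/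
lemma eq_hroot_of_two_le {β : V} (hβ : β ∈ R.roots) (h : 2 ≤ ⟪β, coroot R.hroot⟫) :
    β = R.hroot := by
  have h1 : R.hroot - β ∈ simpleCone R := R.hroot_highest _ hβ
  have h2 : R.hroot - -sRefl R.hroot β ∈ simpleCone R :=
    R.hroot_highest _ (neg_mem_roots (R.refl_mem _ hroot_mem _ hβ))
  have h3 := simpleCone_add h2
    (simpleCone_smul (R.pos_combo _ R.hroot_pos) (sub_nonneg.mpr h))
  refine (sub_eq_zero.mp (simpleCone_salient h1 ?_)).symm
  convert h3 using 1
  rw [sRefl_eq_sub]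
  module

variable (R) in
/-- The simple affine roots: `(α, 0)` for `α` simple, and `(-φ, 1)`. -/
def IsSimpleAffine (a : V × ℤ) : Prop :=
  (a.1 ∈ R.simples ∧ a.2 = 0) ∨ a = (-R.hroot, 1)

lemma IsSimpleAffine.isPosAffine {a : V × ℤ} (ha : IsSimpleAffine R a) : IsPosAffine R a := by
  rcases ha with ⟨h1, h2⟩ | rfl
  · exact ⟨R.simples_sub h1, Or.inr ⟨h2, R.simples_sub_pos h1⟩⟩
  · exact ⟨neg_mem_roots hroot_mem, Or.inl one_pos⟩

/-- A simple affine reflection permutes the other positive affine roots. -/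
lemma IsSimpleAffine.reflAffine_pos {a b : V × ℤ} (ha : IsSimpleAffine R a)
    (hb : IsPosAffine R b) (hne : b ≠ a) : IsPosAffine R (reflAffine a b) := by
  refine ⟨reflAffine_mem ha.isPosAffine.1 hb.1, ?_⟩
  obtain ⟨β, n⟩ := b
  obtain ⟨hβ, hb⟩ := hb
  simp only at hβ hb
  rcases ha with ⟨h1, h2⟩ | rfl
  · obtain ⟨α, m⟩ := a
    simp only at h1 h2
    subst h2
    simp only [reflAffine, zero_mul, sub_zero]
    rcases hb with hb | ⟨rfl, hb⟩
    · exact Or.inl hb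
    · exact Or.inr ⟨rfl, sRefl_mem_pos_of_simple h1 hb fun h => hne (by rw [h])⟩
  · obtain ⟨p, hp⟩ := R.crystallographic _ hroot_mem β hβ
    have hs : sRefl (-R.hroot) β = β - (p : ℝ) • R.hroot := by
      rw [sRefl_eq_sub, coroot_neg, inner_neg_right, hp]; module
    have hr : round ⟪β, coroot (-R.hroot)⟫ = -p := by
      rw [coroot_neg, inner_neg_right, hp]; exact_mod_cast round_intCast (α := ℝ) (-p)
    simp only [reflAffine, hs, hr, one_mul, sub_neg_eq_add]
    have hmem : β - (p : ℝ) • R.hroot ∈ R.roots := by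
      rw [← hs]; exact R.refl_mem _ (neg_mem_roots hroot_mem) _ hβ
    rcases hb with hb | ⟨rfl, hb⟩
    · by_cases hp2 : p ≤ -2
      · have hβ' : -β = R.hroot := by
          refine eq_hroot_of_two_le (neg_mem_roots hβ) ?_
          rw [inner_neg_left, hp]
          have : (p : ℝ) ≤ -2 := by exact_mod_cast hp2
          linarith
        obtain rfl : β = -R.hroot := by rw [← hβ', neg_neg]
        rw [inner_neg_left, inner_coroot_self (R.ne_zero _ hroot_mem)] at hp
        obtain rfl : p = -2 := by exact_mod_cast hp.symm
        have hn : n ≠ 1 := fun h => hne (by rw [h])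
        rcases (by omega : 0 < n + -2 ∨ n + -2 = 0) with h | h
        · exact Or.inl h
        · refine Or.inr ⟨h, ?_⟩
          convert R.hroot_pos using 1
          push_cast; module
      · by_cases h : 0 < n + p
        · exact Or.inl h
        · obtain rfl : p = -1 := by omega
          refine Or.inr ⟨by omega, mem_pos_of_mem_simpleCone hmem ?_⟩
          have : R.hroot - -β ∈ simpleCone R := R.hroot_highest _ (neg_mem_roots hβ)
          convert this using 1
          push_cast; module
    · have hp0 : 0 ≤ p := by
        have := hroot_coroot_nonneg hb
        rw [hp] at this; exact_mod_cast this
      rcases hp0.lt_or_eq with h | rfl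
      · exact Or.inl (by omega)
      · exact Or.inr ⟨by omega, by simpa using hb⟩

lemma inner_nonneg_of_mem_simpleCone {v x : V} (hv : ∀ α ∈ R.simples, 0 ≤ ⟪α, v⟫)
    (hx : x ∈ simpleCone R) : 0 ≤ ⟪x, v⟫ := by
  obtain ⟨c, hc, rfl⟩ := hx
  rw [sum_inner]
  refine Finset.sum_nonneg fun α hα => ?_
  rw [real_inner_smul_left]
  exact mul_nonneg (hc α) (hv α hα)

lemma exists_simple_mem_negAt {v : V} (h : (negAt R v).Nonempty) :
    ∃ a, IsSimpleAffine R a ∧ ⟪a.1, v⟫ + (a.2 : ℝ) < 0 := by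
  by_contra! hcon
  have hv : ∀ α ∈ R.simples, 0 ≤ ⟪α, v⟫ := fun α hα => by
    simpa using hcon (α, 0) (Or.inl ⟨hα, rfl⟩)
  have h0 := hcon (-R.hroot, 1) (Or.inr rfl)
  simp only [inner_neg_left, Int.cast_one] at h0
  obtain ⟨⟨α, m⟩, ⟨hα, hpos⟩, hneg⟩ := h
  simp only at hα hpos hneg
  rcases hpos with hm | ⟨rfl, hα'⟩
  · have h1 := inner_nonneg_of_mem_simpleCone hv (R.hroot_highest _ (neg_mem_roots hα))
    rw [inner_sub_left, inner_neg_left] at h1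
    have : (1 : ℝ) ≤ m := by exact_mod_cast hm
    linarith
  · have := inner_nonneg_of_mem_simpleCone hv (R.pos_combo _ hα')
    simp only [Int.cast_zero] at hneg
    linarith

/-- If the simple affine root `a` is negative at `v`, then `a` together with the image under `s_a`
of the positive affine roots negative at `s_a v` are those negative at `v`. -/
lemma negAt_eq_insert {a : V × ℤ} (ha : IsSimpleAffine R a) {v : V}
    (hav : ⟪a.1, v⟫ + (a.2 : ℝ) < 0) :
    negAt R v = insert a (reflAffine a '' negAt R (affRefl a v)) := by
  have har := ha.isPosAffine.1
  have h0 := R.ne_zero _ har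
  ext c
  constructor
  · rintro ⟨hc, hcv⟩
    by_cases hca : c = a
    · exact Or.inl hca
    · refine Or.inr ⟨reflAffine a c, ⟨ha.reflAffine_pos hc hca, ?_⟩,
        reflAffine_reflAffine har hc.1⟩
      rwa [eval_reflAffine har hc.1, affRefl_affRefl h0]
  · rintro (rfl | ⟨b, ⟨hb, hbv⟩, rfl⟩)
    · exact ⟨ha.isPosAffine, hav⟩
    · refine ⟨ha.reflAffine_pos hb ?_, ?_⟩
      · rintro rfl
        rw [inner_affRefl_self h0] at hbv
        linarith
      · rwa [eval_reflAffine har hb.1]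

lemma injOn_reflAffine {a : V × ℤ} (ha : a.1 ∈ R.roots) (v : V) :
    Set.InjOn (reflAffine a) (negAt R v) := fun b hb c hc h => by
  rw [← reflAffine_reflAffine ha hb.1.1, h, reflAffine_reflAffine ha hc.1.1]

lemma notMem_image_reflAffine {a : V × ℤ} (ha : IsPosAffine R a) (v : V) :
    a ∉ reflAffine a '' negAt R v := by
  rintro ⟨b, ⟨hb, -⟩, hba⟩
  apply ha.not_neg
  have h := reflAffine_reflAffine ha.1 hb.1
  rw [hba, reflAffine_self ha.1] at h
  rwa [h]

/-! ### The reflection part of the Dunkl operator -/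

variable (R) in
/-- The reflection part of the Dunkl-type operator. -/
noncomputable def reflPart (k : V → ℝ) (u : V) (f : V → ℂ) (v : V) : ℂ :=
  ∑ᶠ a ∈ negAt R v, ((k a.1 * ⟪a.1, u⟫ : ℝ) : ℂ) * f (affRefl a v)

lemma dunkl_eq (k : V → ℝ) (u : V) (f : V → ℂ) (v : V) :
    dunkl R k u f v = fderiv ℝ f v u + reflPart R k u f v := rfl

lemma reflPart_eq_sum (k : V → ℝ) (u : V) (f : V → ℂ) (v : V) :
    reflPart R k u f v = ∑ a ∈ (finite_negAt (R := R) v).toFinset,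
      ((k a.1 * ⟪a.1, u⟫ : ℝ) : ℂ) * f (affRefl a v) :=
  finsum_mem_eq_finite_toFinset_sum _ _

lemma reflPart_congr (k : V → ℝ) (u : V) {f g : V → ℂ} (h : Set.EqOn f g (VregSet R)) {v : V}
    (hv : v ∈ VregSet R) : reflPart R k u f v = reflPart R k u g v :=
  finsum_mem_congr rfl fun _ ha => by rw [h (affRefl_mem_VregSet ha.1.1 hv)]

lemma dunkl_congr (k : V → ℝ) (u : V) {f g : V → ℂ} (h : Set.EqOn f g (VregSet R)) {v : V}
    (hv : v ∈ VregSet R) : dunkl R k u f v = dunkl R k u g v := by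
  rw [dunkl_eq, dunkl_eq, reflPart_congr k u h hv,
    (h.eventuallyEq_of_mem (isOpen_VregSet.mem_nhds hv)).fderiv_eq]

lemma dunkl_add_const_mul (k : V → ℝ) (u : V) {f g : V → ℂ} (c : ℂ) {v : V}
    (hf : DifferentiableAt ℝ f v) (hg : DifferentiableAt ℝ g v) :
    dunkl R k u (fun w => f w + c * g w) v = dunkl R k u f v + c * dunkl R k u g v := by
  have h1 : fderiv ℝ (fun w => f w + c * g w) v = fderiv ℝ f v + c • fderiv ℝ g v :=
    (hf.hasFDerivAt.add (hg.hasFDerivAt.const_mul c)).fderiv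
  rw [dunkl_eq, dunkl_eq, dunkl_eq, h1, reflPart_eq_sum, reflPart_eq_sum, reflPart_eq_sum]
  simp only [mul_add, Finset.sum_add_distrib, add_apply,
    smul_apply, smul_eq_mul, Finset.mul_sum, mul_left_comm c]
  ring

lemma dunkl_sub_smul (k : V → ℝ) (u x : V) (c : ℝ) (f : V → ℂ) (v : V) :
    dunkl R k (u - c • x) f v = dunkl R k u f v - c * dunkl R k x f v := by
  rw [dunkl_eq, dunkl_eq, dunkl_eq, reflPart_eq_sum, reflPart_eq_sum, reflPart_eq_sum]
  simp only [map_sub, map_smul, Complex.real_smul, inner_sub_right, real_inner_smul_right,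
    mul_add, Finset.mul_sum]
  rw [add_sub_add_comm, ← Finset.sum_sub_distrib]
  congr 1
  refine Finset.sum_congr rfl fun a _ => ?_
  push_cast; ring

lemma contDiffOn_dunkl (k : V → ℝ) (u : V) {f : V → ℂ}
    (hf : ContDiffOn ℝ (⊤ : ℕ∞) f (VregSet R)) :
    ContDiffOn ℝ (⊤ : ℕ∞) (dunkl R k u f) (VregSet R) := by
  have h1 : ContDiffOn ℝ (⊤ : ℕ∞) (fun v => fderiv ℝ f v u) (VregSet R) :=
    (hf.fderiv_of_isOpen isOpen_VregSet (by simp)).clm_apply contDiffOn_const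
  intro v hv
  refine ContDiffAt.contDiffWithinAt ?_
  refine ContDiffAt.add (h1.contDiffAt (isOpen_VregSet.mem_nhds hv)) ?_
  have h2 : ContDiffAt ℝ (⊤ : ℕ∞) (fun w => ∑ a ∈ (finite_negAt (R := R) v).toFinset,
      ((k a.1 * ⟪a.1, u⟫ : ℝ) : ℂ) * f (affRefl a w)) v := by
    refine ContDiffAt.sum fun a ha => contDiffAt_const.mul ?_
    have har : a.1 ∈ R.roots := ((finite_negAt v).mem_toFinset.mp ha).1.1
    exact (hf.contDiffAt (isOpen_VregSet.mem_nhds (affRefl_mem_VregSet har hv))).comp v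
      (contDiff_affRefl a).contDiffAt
  refine h2.congr_of_eventuallyEq ?_
  filter_upwards [negAt_eventually_eq hv] with w hw
  rw [← finsum_mem_eq_finite_toFinset_sum _ (finite_negAt v), ← hw]
  rfl

/-! ### The cross relation and commutativity -/

lemma reflPart_comp_affRefl_of_neg {k : V → ℝ} (hk : IsMultiplicity R k) {a : V × ℤ}
    (ha : IsSimpleAffine R a) (u : V) (f : V → ℂ) {v : V} (hav : ⟪a.1, v⟫ + (a.2 : ℝ) < 0) :
    reflPart R k u f (affRefl a v) =
      reflPart R k (sRefl a.1 u) (f ∘ affRefl a) v + ((k a.1 * ⟪a.1, u⟫ : ℝ) : ℂ) * f v := by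
  have har := ha.isPosAffine.1
  have h0 := R.ne_zero _ har
  have hr : reflPart R k (sRefl a.1 u) (f ∘ affRefl a) v =
      -(((k a.1 * ⟪a.1, u⟫ : ℝ) : ℂ) * f v) + reflPart R k u f (affRefl a v) := by
    unfold reflPart
    rw [negAt_eq_insert ha hav, finsum_mem_insert _ (notMem_image_reflAffine ha.isPosAffine _)
      ((finite_negAt _).image _), finsum_mem_image (injOn_reflAffine har _)]
    congr 1
    · rw [Function.comp_apply, affRefl_affRefl h0, inner_sRefl_self h0]
      push_cast; ring
    · refine finsum_mem_congr rfl fun b hb => ?_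
      have hbr := hb.1.1
      rw [Function.comp_apply, affRefl_reflAffine har hbr, affRefl_affRefl h0]
      simp only [reflAffine]
      rw [multiplicity_sRefl hk har hbr, inner_sRefl_left, sRefl_sRefl h0]
  rw [hr]; ring

lemma reflPart_comp_affRefl {k : V → ℝ} (hk : IsMultiplicity R k) {a : V × ℤ}
    (ha : IsSimpleAffine R a) (u : V) (f : V → ℂ) {v : V} (hv : v ∈ VregSet R) :
    reflPart R k u f (affRefl a v) =
      reflPart R k (sRefl a.1 u) (f ∘ affRefl a) v + ((k a.1 * ⟪a.1, u⟫ : ℝ) : ℂ) * f v := by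
  have har := ha.isPosAffine.1
  have h0 := R.ne_zero _ har
  rcases (hv a.1 har a.2).lt_or_gt with h | h
  · exact reflPart_comp_affRefl_of_neg hk ha u f h
  · have h' := reflPart_comp_affRefl_of_neg hk ha (sRefl a.1 u) (f ∘ affRefl a)
      (v := affRefl a v) (by rw [inner_affRefl_self h0]; linarith)
    have hff : (f ∘ affRefl a) ∘ affRefl a = f := by
      funext w; simp [affRefl_affRefl h0]
    rw [hff, affRefl_affRefl h0, sRefl_sRefl h0, inner_sRefl_self h0, Function.comp_apply,
      affRefl_affRefl h0] at h'
    rw [h']; push_cast; ring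

/-- The cross relation of the degenerate affine Hecke algebra. -/
lemma dunkl_affRefl {k : V → ℝ} (hk : IsMultiplicity R k) {a : V × ℤ}
    (ha : IsSimpleAffine R a) (u : V) {f : V → ℂ} (hf : DifferentiableOn ℝ f (VregSet R)) {v : V}
    (hv : v ∈ VregSet R) :
    dunkl R k u f (affRefl a v) =
      dunkl R k (sRefl a.1 u) (f ∘ affRefl a) v + ((k a.1 * ⟪a.1, u⟫ : ℝ) : ℂ) * f v := by
  have har := ha.isPosAffine.1
  have hd : DifferentiableAt ℝ f (affRefl a v) :=
    hf.differentiableAt (isOpen_VregSet.mem_nhds (affRefl_mem_VregSet har hv))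
  have hfd : fderiv ℝ (f ∘ affRefl a) v (sRefl a.1 u) = fderiv ℝ f (affRefl a v) u := by
    rw [(hd.hasFDerivAt.comp v (hasFDerivAt_affRefl a v)).fderiv]
    exact congrArg _ (sRefl_sRefl (R.ne_zero _ har) u)
  rw [dunkl_eq, dunkl_eq, hfd, reflPart_comp_affRefl hk ha u f hv]
  ring

lemma dunkl_dunkl_affRefl {k : V → ℝ} (hk : IsMultiplicity R k) {a : V × ℤ}
    (ha : IsSimpleAffine R a) (u u' : V) {f : V → ℂ}
    (hf : ContDiffOn ℝ (⊤ : ℕ∞) f (VregSet R)) {v : V} (hv : v ∈ VregSet R) :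
    dunkl R k u (dunkl R k u' f) (affRefl a v) =
      dunkl R k (sRefl a.1 u) (dunkl R k (sRefl a.1 u') (f ∘ affRefl a)) v +
      ((k a.1 * ⟪a.1, u'⟫ : ℝ) : ℂ) * dunkl R k (sRefl a.1 u) f v +
      ((k a.1 * ⟪a.1, u⟫ : ℝ) : ℂ) * dunkl R k u' f v := by
  have hdiff {g : V → ℂ} (hg : ContDiffOn ℝ (⊤ : ℕ∞) g (VregSet R)) :
      DifferentiableOn ℝ g (VregSet R) := hg.differentiableOn (by simp)
  have hfa : ContDiffOn ℝ (⊤ : ℕ∞) (f ∘ affRefl a) (VregSet R) :=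
    hf.comp (contDiff_affRefl a).contDiffOn
      fun w hw => affRefl_mem_VregSet ha.isPosAffine.1 hw
  have hnhds := isOpen_VregSet.mem_nhds hv
  rw [dunkl_affRefl hk ha u (hdiff (contDiffOn_dunkl k u' hf)) hv]
  rw [dunkl_congr k _ (f := dunkl R k u' f ∘ affRefl a)
      (fun w hw => dunkl_affRefl hk ha u' (hdiff hf) hw) hv,
    dunkl_add_const_mul k _ _
      ((hdiff (contDiffOn_dunkl k _ hfa)).differentiableAt hnhds)
      ((hdiff hf).differentiableAt hnhds)]

lemma dunkl_comm_of_negAt_eq_empty (k : V → ℝ) (u u' : V) {f : V → ℂ}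
    (hf : ContDiffOn ℝ (⊤ : ℕ∞) f (VregSet R)) {v : V} (hv : v ∈ VregSet R)
    (hN : negAt R v = ∅) :
    dunkl R k u (dunkl R k u' f) v = dunkl R k u' (dunkl R k u f) v := by
  have hrefl (x w : V) (g : V → ℂ) (hw : negAt R w = ∅) :
      dunkl R k x g w = fderiv ℝ g w x := by
    rw [dunkl_eq, reflPart, hw, finsum_mem_empty, add_zero]
  have hev (x : V) : dunkl R k x f =ᶠ[nhds v] fun w => fderiv ℝ f w x := by
    filter_upwards [negAt_eventually_eq hv] with w hw
    exact hrefl x w f (hw.trans hN)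
  have hfv := hf.contDiffAt (isOpen_VregSet.mem_nhds hv)
  have hd : DifferentiableAt ℝ (fderiv ℝ f) v :=
    (hfv.fderiv_right (m := 1) (by norm_cast)).differentiableAt (by simp)
  have happ (x y : V) : fderiv ℝ (fun w => fderiv ℝ f w x) v y = fderiv ℝ (fderiv ℝ f) v y x := by
    rw [fderiv_clm_apply hd (differentiableAt_const x)]
    simp
  rw [hrefl _ _ _ hN, hrefl _ _ _ hN, (hev u).fderiv_eq, (hev u').fderiv_eq, happ, happ]
  exact (hfv.isSymmSndFDerivAt (by simp; norm_cast)).eq u u'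

lemma dunkl_comm {k : V → ℝ} (hk : IsMultiplicity R k) {f : V → ℂ}
    (hf : ContDiffOn ℝ (⊤ : ℕ∞) f (VregSet R)) (u u' : V) {v : V} (hv : v ∈ VregSet R) :
    dunkl R k u (dunkl R k u' f) v = dunkl R k u' (dunkl R k u f) v := by
  induction hn : (negAt R v).ncard using Nat.strong_induction_on generalizing v f u u' with
  | _ n ih =>
  rcases (negAt R v).eq_empty_or_nonempty with hN | hN
  · exact dunkl_comm_of_negAt_eq_empty k u u' hf hv hN
  obtain ⟨a, ha, hav⟩ := exists_simple_mem_negAt hN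
  have har := ha.isPosAffine.1
  have hw := affRefl_mem_VregSet har hv
  have hlt : (negAt R (affRefl a v)).ncard < n := by
    rw [← hn, negAt_eq_insert ha hav, Set.ncard_insert_of_notMem
      (notMem_image_reflAffine ha.isPosAffine _) ((finite_negAt _).image _),
      (injOn_reflAffine har _).ncard_image]
    exact Nat.lt_succ_self _
  have hfa : ContDiffOn ℝ (⊤ : ℕ∞) (f ∘ affRefl a) (VregSet R) :=
    hf.comp (contDiff_affRefl a).contDiffOn fun w hw => affRefl_mem_VregSet har hw
  have h1 := dunkl_dunkl_affRefl hk ha u u' hf hw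
  have h2 := dunkl_dunkl_affRefl hk ha u' u hf hw
  rw [affRefl_affRefl (R.ne_zero _ har)] at h1 h2
  rw [h1, h2, ih _ hlt hfa _ _ hw rfl]
  simp only [sRefl, dunkl_sub_smul]
  push_cast
  ring

end DunklCommutation

noncomputable section

/-- For every `f` smooth on `V_reg` and `u ∈ V`, `D_u^k f` is smooth on
`V_reg`, and the Dunkl-type operators pairwise commute on `V_reg`. -/
theorem statement18
    {V : Type*} [NormedAddCommGroup V] [InnerProductSpace ℝ V] [FiniteDimensional ℝ V]
    (R : RootSystemBase V) (k : V → ℝ) (hk : IsMultiplicity R k)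
    (f : V → ℂ) (hf : ContDiffOn ℝ (⊤ : ℕ∞) f (VregSet R)) (u u' : V) :
    ContDiffOn ℝ (⊤ : ℕ∞) (dunkl R k u f) (VregSet R) ∧
    ∀ v ∈ VregSet R,
      dunkl R k u (dunkl R k u' f) v = dunkl R k u' (dunkl R k u f) v := by
  exact ⟨contDiffOn_dunkl k u hf, fun v hv => dunkl_comm hk hf u u' hv⟩

end
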